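/- For a finite irreducible directed graph G on vertex set S (each vertex having at least one outgoing edge), the growth rate max_x lim_n (1/n) log N_n(x) of the number N_n(x) of directed paths of length n starting from x equals the maximum entropy rate sup_{(Π,π)} −Σ_{x,y} π(x)π(y|x) log π(y|x), where the supremum is over G-compatible stochastic matrices Π = [π(y|x)] (π(y|x) > 0 implies (x,y) ∈ E_G) and π invariant for Π. -/

import Mathlib

open Filter

lemma aux_sum_le {S : Type*} [Fintype S] (M : Matrix S S ℝ) (hM : ∀ x y, 0 < M x y)
    (z : S → ℝ) (hz : ∀ x, 0 ≤ z x) (hne : ∃ x, 0 < z x) (x : S) : 0 < (M.mulVec z) x := by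
  obtain ⟨y, hy⟩ := hne
  exact Finset.sum_pos' (fun i _ => mul_nonneg (hM x i).le (hz i))
    ⟨y, Finset.mem_univ _, mul_pos (hM x y) hy⟩

lemma aux_pow_nonneg {S : Type*} [Fintype S] [DecidableEq S] (A : Matrix S S ℝ)
    (h0 : ∀ x y, 0 ≤ A x y) (n : ℕ) : ∀ x y, 0 ≤ (A ^ n) x y := by
  induction n with
  | zero => intro x y; simp only [pow_zero, Matrix.one_apply]; split_ifs <;> norm_num
  | succ n ih =>
    intro x y
    rw [pow_succ, Matrix.mul_apply]
    exact Finset.sum_nonneg fun i _ => mul_nonneg (ih x i) (h0 i y)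

lemma aux_pf {S : Type*} [Fintype S] [Nonempty S] [DecidableEq S] (A : Matrix S S ℝ)
    (h0 : ∀ x y, 0 ≤ A x y) (hirr : ∀ x y, ∃ n : ℕ, 0 < n ∧ 0 < (A ^ n) x y) :
    ∃ (r : ℝ) (v : S → ℝ), (∀ x, 0 < v x) ∧ ∀ x, ∑ y, A x y * v y = r * v x := by
  choose n hn hpos using hirr
  obtain ⟨K, hK⟩ : ∃ K, ∀ x y, n x y < K := by
    refine ⟨(∑ x, ∑ y, n x y) + 1, fun x y => Nat.lt_succ_of_le ?_⟩
    exact (Finset.single_le_sum (f := fun y => n x y) (fun _ _ => Nat.zero_le _)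
      (Finset.mem_univ y)).trans (Finset.single_le_sum (f := fun x => ∑ y, n x y)
      (fun _ _ => Nat.zero_le _) (Finset.mem_univ x))
  set B : Matrix S S ℝ := ∑ k ∈ Finset.range K, A ^ k with hB
  have hBpos : ∀ x y, 0 < B x y := by
    intro x y
    rw [hB, Matrix.sum_apply]
    exact Finset.sum_pos' (fun i _ => aux_pow_nonneg A h0 i x y)
      ⟨n x y, Finset.mem_range.2 (hK x y), hpos x y⟩
  have hcomm : A * B = B * A := by
    rw [hB, Finset.mul_sum, Finset.sum_mul]
    exact Finset.sum_congr rfl fun k _ => (pow_mul_comm' A k).symm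
  have hsimp : ∀ z ∈ stdSimplex ℝ S, ∀ x, 0 < (B.mulVec z) x := by
    intro z hz x
    refine aux_sum_le B hBpos z hz.1 ?_ x
    by_contra! h
    have := Finset.sum_nonpos (fun i (_ : i ∈ Finset.univ) => h i)
    rw [hz.2] at this
    linarith
  let f : (S → ℝ) → ℝ := fun z => Finset.univ.inf' Finset.univ_nonempty
    (fun x => (A.mulVec (B.mulVec z)) x / (B.mulVec z) x)
  have hf : ContinuousOn f (stdSimplex ℝ S) := by
    refine ContinuousOn.finset_inf'_apply _ fun x _ => ?_
    refine ContinuousOn.div ?_ ?_ fun z hz => (hsimp z hz x).ne'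
    · refine Continuous.continuousOn ?_
      unfold Matrix.mulVec dotProduct
      fun_prop
    · refine Continuous.continuousOn ?_
      unfold Matrix.mulVec dotProduct
      fun_prop
  obtain ⟨z, hz, hmax⟩ := (isCompact_stdSimplex ℝ S).exists_isMaxOn
    ⟨_, single_mem_stdSimplex ℝ (Classical.arbitrary S)⟩ hf
  set w := B.mulVec z with hw
  have hwp := hsimp z hz
  rw [← hw] at hwp
  have hge : ∀ x, f z * w x ≤ (A.mulVec w) x := by
    intro x
    rw [← le_div_iff₀ (hwp x)]
    exact Finset.inf'_le _ (Finset.mem_univ x)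
  refine ⟨f z, w, hwp, fun x => ?_⟩
  by_contra hx
  have hx' : f z * w x < (A.mulVec w) x := lt_of_le_of_ne (hge x) (fun h => hx h.symm)
  have key := aux_sum_le B hBpos (A.mulVec w - f z • w)
    (fun y => by simpa using hge y) ⟨x, by simpa using hx'⟩
  have hs : 0 < ∑ y, w y := Finset.sum_pos (fun i _ => hwp i) Finset.univ_nonempty
  have hmem : (∑ y, w y)⁻¹ • w ∈ stdSimplex ℝ S := by
    refine ⟨fun y => mul_nonneg (inv_nonneg.2 hs.le) (hwp y).le, ?_⟩
    simp only [Pi.smul_apply, smul_eq_mul, ← Finset.mul_sum]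
    exact inv_mul_cancel₀ hs.ne'
  have hlt : f z < f ((∑ y, w y)⁻¹ • w) := by
    refine (Finset.lt_inf'_iff _).2 fun y _ => ?_
    have hp := hsimp _ hmem y
    rw [lt_div_iff₀ hp]
    have h1 := key y
    rw [Matrix.mulVec_sub, Matrix.mulVec_smul, Matrix.mulVec_mulVec, ← hcomm,
      ← Matrix.mulVec_mulVec] at h1
    simp only [Pi.sub_apply, Pi.smul_apply, smul_eq_mul] at h1
    simp only [Matrix.mulVec_smul, Pi.smul_apply, smul_eq_mul]
    have := mul_pos (inv_pos.2 hs) h1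
    nlinarith
  exact absurd (hmax hmem) (not_le.2 hlt)

lemma aux_growth {S : Type*} [Fintype S] [Nonempty S] [DecidableEq S] (A : Matrix S S ℝ)
    (h0 : ∀ x y, 0 ≤ A x y) (r : ℝ) (hr : 0 < r) (v : S → ℝ) (hv : ∀ x, 0 < v x)
    (hAv : ∀ x, ∑ y, A x y * v y = r * v x) (x : S) :
    Tendsto (fun n : ℕ => Real.log (∑ y, (A ^ n) x y) / n) atTop (nhds (Real.log r)) := by
  have hpow : ∀ n : ℕ, ∑ y, (A ^ n) x y * v y = r ^ n * v x := by
    have : ∀ n : ℕ, (A ^ n).mulVec v = r ^ n • v := by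
      intro n
      induction n with
      | zero => simp
      | succ n ih =>
        have hA1 : A.mulVec v = r • v := by ext x; exact hAv x
        rw [pow_succ, ← Matrix.mulVec_mulVec, hA1, Matrix.mulVec_smul, ih, smul_smul, pow_succ,
          mul_comm]
    intro n
    exact congrFun (this n) x
  obtain ⟨a, ha⟩ := Finite.exists_min v
  obtain ⟨b, hb⟩ := Finite.exists_max v
  have h1 : ∀ n : ℕ, r ^ n * (v x / v b) ≤ ∑ y, (A ^ n) x y := by
    intro n
    rw [← mul_div_assoc, div_le_iff₀ (hv b), ← hpow, Finset.sum_mul]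
    exact Finset.sum_le_sum fun y _ =>
      mul_le_mul_of_nonneg_left (hb y) (aux_pow_nonneg A h0 n x y)
  have h2 : ∀ n : ℕ, ∑ y, (A ^ n) x y ≤ r ^ n * (v x / v a) := by
    intro n
    rw [← mul_div_assoc, le_div_iff₀ (hv a), ← hpow, Finset.sum_mul]
    exact Finset.sum_le_sum fun y _ =>
      mul_le_mul_of_nonneg_left (ha y) (aux_pow_nonneg A h0 n x y)
  have hlim : ∀ c : ℝ, Tendsto (fun n : ℕ => Real.log r + c / n) atTop (nhds (Real.log r)) := by
    intro c
    simpa using (tendsto_const_div_atTop_nhds_zero_nat c).const_add (Real.log r)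
  have hlog : ∀ c : ℝ, 0 < c → ∀ n : ℕ, 0 < n →
      Real.log (r ^ n * c) / n = Real.log r + Real.log c / n := by
    intro c hc n hn
    have : (n : ℝ) ≠ 0 := by positivity
    rw [Real.log_mul (by positivity) hc.ne', Real.log_pow]
    field_simp
  have hcb := div_pos (hv x) (hv b)
  have hca := div_pos (hv x) (hv a)
  refine tendsto_of_tendsto_of_tendsto_of_le_of_le' (hlim (Real.log (v x / v b)))
    (hlim (Real.log (v x / v a))) ?_ ?_
  · filter_upwards [eventually_gt_atTop 0] with n hn
    rw [← hlog _ hcb n hn]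
    exact div_le_div_of_nonneg_right (Real.log_le_log (by positivity) (h1 n)) (by positivity)
  · filter_upwards [eventually_gt_atTop 0] with n hn
    rw [← hlog _ hca n hn]
    exact div_le_div_of_nonneg_right
      (Real.log_le_log (lt_of_lt_of_le (by positivity) (h1 n)) (h2 n)) (by positivity)

lemma aux_sum_eq {S : Type*} [Fintype S] (P Q : Matrix S S ℝ) (π l : S → ℝ) (c : ℝ)
    (hP : ∀ x, ∑ y, P x y = 1) (hQ : ∀ x, ∑ y, Q x y = 1) (hπ : ∑ x, π x = 1)
    (hinv : ∀ y, ∑ x, π x * P x y = π y) :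
    ∑ x, ∑ y, π x * (Q x y - P x y + P x y * (c + l x - l y)) = c := by
  have e : ∀ x, ∑ y, π x * (Q x y - P x y + P x y * (c + l x - l y))
      = π x * c + π x * l x - ∑ y, π x * P x y * l y := by
    intro x
    have : ∀ y, π x * (Q x y - P x y + P x y * (c + l x - l y))
      = π x * Q x y - π x * P x y + (π x * (c + l x)) * P x y - π x * P x y * l y := by
      intro y; ring
    simp only [this, Finset.sum_sub_distrib, Finset.sum_add_distrib, ← Finset.mul_sum, hP, hQ]
    ring
  simp only [e, Finset.sum_sub_distrib, Finset.sum_add_distrib, ← Finset.sum_mul, hπ]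
  rw [Finset.sum_comm]
  simp only [← Finset.sum_mul, hinv]
  ring

/-- path counting on a finite irreducible directed graph. Let `A` be the
adjacency matrix of a directed graph `E` on the finite vertex set `S` in which every vertex
has an outgoing edge and which is irreducible. Let `N n x = Σ_y (Aⁿ)(x,y)` count directed
paths of length `n` from `x`. Then the growth rate `lim_n (1/n) log N_n(x)` exists,
is independent of `x`, and equals the maximal entropy rate
`sup { −Σ_{x,y} π(x) P(x,y) log P(x,y) }` over `G`-compatible stochastic matrices `P`
with invariant distribution `π`. -/
theorem path_counting_growth_rate_eq_max_entropy_rate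
    {S : Type*} [Fintype S] [Nonempty S] [DecidableEq S]
    (E : S → S → Prop) [DecidableRel E]
    (hout : ∀ x, ∃ y, E x y)
    (A : Matrix S S ℝ) (hA : ∀ x y, A x y = if E x y then 1 else 0)
    (hirr : ∀ x y, ∃ n : ℕ, 0 < n ∧ 0 < (A ^ n) x y) :
    ∃ L : ℝ,
      (∀ x : S, Tendsto (fun n : ℕ => Real.log (∑ y, (A ^ n) x y) / n) atTop (nhds L)) ∧
      L = sSup {h : ℝ | ∃ (P : Matrix S S ℝ) (π : S → ℝ),
        (∀ x y, 0 ≤ P x y) ∧ (∀ x, ∑ y, P x y = 1) ∧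
        (∀ x y, 0 < P x y → E x y) ∧
        (∀ x, 0 ≤ π x) ∧ (∑ x, π x = 1) ∧
        (∀ y, ∑ x, π x * P x y = π y) ∧
        h = -∑ x, ∑ y, π x * P x y * Real.log (P x y)} := by
  have h0 : ∀ x y, 0 ≤ A x y := by
    intro x y; rw [hA]; split_ifs <;> norm_num
  obtain ⟨r, v, hv, hAv⟩ := aux_pf A h0 hirr
  obtain ⟨r', u, hu, hAu⟩ := aux_pf A.transpose (fun x y => h0 y x) (fun x y => by
    obtain ⟨n, hn, hp⟩ := hirr y x
    exact ⟨n, hn, by rw [← Matrix.transpose_pow]; exact hp⟩)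
  simp only [Matrix.transpose_apply] at hAu
  have hr : 0 < r := by
    have x := Classical.arbitrary S
    obtain ⟨y, hy⟩ := hout x
    have : 0 < r * v x := by
      rw [← hAv]
      exact Finset.sum_pos' (fun i _ => mul_nonneg (h0 x i) (hv i).le)
        ⟨y, Finset.mem_univ _, mul_pos (by rw [hA, if_pos hy]; norm_num) (hv y)⟩
    exact pos_of_mul_pos_left this (hv x).le
  have hs : 0 < ∑ x, u x * v x :=
    Finset.sum_pos (fun i _ => mul_pos (hu i) (hv i)) Finset.univ_nonempty
  have hrr : r' = r := by
    have e1 : ∑ x, u x * ∑ y, A x y * v y = r * ∑ x, u x * v x := by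
      simp only [hAv, Finset.mul_sum]
      exact Finset.sum_congr rfl fun _ _ => by ring
    have e2 : ∑ x, u x * ∑ y, A x y * v y = r' * ∑ x, u x * v x := by
      simp only [Finset.mul_sum]
      rw [Finset.sum_comm]
      refine Finset.sum_congr rfl fun y _ => ?_
      rw [← mul_assoc, ← hAu, Finset.sum_mul]
      exact Finset.sum_congr rfl fun _ _ => by ring
    exact mul_right_cancel₀ hs.ne' (e2.symm.trans e1)
  subst hrr
  refine ⟨Real.log r', aux_growth A h0 r' hr v hv hAv, ?_⟩
  let Q : Matrix S S ℝ := fun x y => A x y * v y / (r' * v x)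
  have hQ0 : ∀ x y, 0 ≤ Q x y := fun x y =>
    div_nonneg (mul_nonneg (h0 x y) (hv y).le) (mul_pos hr (hv x)).le
  have hQ1 : ∀ x, ∑ y, Q x y = 1 := by
    intro x
    simp only [Q]
    rw [← Finset.sum_div, hAv, div_self (mul_pos hr (hv x)).ne']
  have hQE : ∀ x y, 0 < Q x y → E x y := by
    intro x y h
    by_contra hE
    simp [Q, hA, hE] at h
  have hQlog : ∀ x y, E x y → 0 < Q x y ∧
      -Real.log (Q x y) = Real.log r' + Real.log (v x) - Real.log (v y) := by
    intro x y h
    have hvx := hv x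
    have hvy := hv y
    have : Q x y = v y / (r' * v x) := by simp [Q, hA, h]
    rw [this]
    refine ⟨by positivity, ?_⟩
    rw [Real.log_div hvy.ne' (by positivity), Real.log_mul hr.ne' hvx.ne']
    ring
  symm
  refine IsGreatest.csSup_eq ⟨?_, ?_⟩
  · have hi : ∀ y, ∑ x, (u x * v x / ∑ x, u x * v x) * Q x y = u y * v y / ∑ x, u x * v x := by
      intro y
      have : ∀ x, (u x * v x / ∑ x, u x * v x) * Q x y
          = (A x y * u x) * (v y / (r' * ∑ x, u x * v x)) := by
        intro x
        have := (hv x).ne'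
        simp only [Q]
        field_simp
      simp only [this]
      rw [← Finset.sum_mul, hAu]
      field_simp
    have hp1 : ∑ x, (u x * v x / ∑ x, u x * v x) = 1 := by
      rw [← Finset.sum_div, div_self hs.ne']
    refine ⟨Q, fun x => u x * v x / ∑ x, u x * v x, hQ0, hQ1, hQE,
      fun x => div_nonneg (mul_pos (hu x) (hv x)).le hs.le, hp1, hi, ?_⟩
    rw [← aux_sum_eq Q Q (fun x => u x * v x / ∑ x, u x * v x) (fun x => Real.log (v x))
      (Real.log r') hQ1 hQ1 hp1 hi]
    simp only [← Finset.sum_neg_distrib]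
    refine Finset.sum_congr rfl fun x _ => Finset.sum_congr rfl fun y _ => ?_
    rcases (hQ0 x y).eq_or_lt with h | h
    · simp [← h]
    · rw [← (hQlog x y (hQE x y h)).2]; ring
  · rintro h ⟨P, π, hP0, hP1, hPE, hπ0, hπ1, hinv, rfl⟩
    rw [← aux_sum_eq P Q π (fun x => Real.log (v x)) (Real.log r') hP1 hQ1 hπ1 hinv]
    simp only [← Finset.sum_neg_distrib]
    refine Finset.sum_le_sum fun x _ => Finset.sum_le_sum fun y _ => ?_
    have : -(π x * P x y * Real.log (P x y)) = π x * (-(P x y * Real.log (P x y))) := by ring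
    rw [this]
    refine mul_le_mul_of_nonneg_left ?_ (hπ0 x)
    rcases (hP0 x y).eq_or_lt with h | h
    · simp [← h, hQ0 x y]
    · obtain ⟨hq, hl⟩ := hQlog x y (hPE x y h)
      rw [← hl]
      have h3 := Real.log_le_sub_one_of_pos (div_pos hq h)
      rw [Real.log_div hq.ne' h.ne'] at h3
      have h4 := mul_le_mul_of_nonneg_left h3 h.le
      have h5 : P x y * (Q x y / P x y - 1) = Q x y - P x y := by field_simp
      rw [h5] at h4
      linarith
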